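/- Let t¹ ∈ ℝ with t¹ ≠ 0, and consider on the half-plane U = {(x¹,x²) ∈ ℝ² : x¹ > 0} the connection with Christoffel symbols Γ_{11}¹ = 1, Γ_{12}¹ = t¹/x¹, Γ_{21}¹ = −t¹/x¹, Γ_{12}² = Γ_{21}² = 1, and all other Γ_{ij}^k = 0 (the flat Type A surface M₁⁶ perturbed by the Type B torsion T¹ = t¹/x¹, T² = 0). Then a smooth vector field X on U is an affine Killing vector field for this connection if and only if X is a constant multiple of the vector field (0,1). -/

import Mathlib

open Real

/-- The partial derivative `∂f/∂x^i` of a function on `ℝ²` (points are `Fin 2 → ℝ`). -/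
noncomputable def pd (f : (Fin 2 → ℝ) → ℝ) (i : Fin 2) (p : Fin 2 → ℝ) : ℝ :=
  fderiv ℝ f p (Pi.single i 1)

/-- The affine Killing operator
`K^Γ_{ij}^k(v) = ∂_i∂_j v^k + v^l ∂_l Γ_{ij}^k − Γ_{ij}^l ∂_l v^k + Γ_{il}^k ∂_j v^l + Γ_{lj}^k ∂_i v^l`
(summation over `l`). -/
noncomputable def killingOp (Γ : Fin 2 → Fin 2 → Fin 2 → (Fin 2 → ℝ) → ℝ)
    (v : Fin 2 → (Fin 2 → ℝ) → ℝ) (i j k : Fin 2) (p : Fin 2 → ℝ) : ℝ :=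
  pd (fun q => pd (v k) j q) i p
    + (∑ l : Fin 2, v l p * pd (Γ i j k) l p)
    - (∑ l : Fin 2, Γ i j l p * pd (v k) l p)
    + (∑ l : Fin 2, Γ i l k p * pd (v l) j p)
    + (∑ l : Fin 2, Γ l j k p * pd (v l) i p)

/-- `v` is an affine Killing vector field for the connection `Γ` on `U`:
all eight affine Killing equations hold on `U`. -/
def IsAffineKilling (U : Set (Fin 2 → ℝ))
    (Γ : Fin 2 → Fin 2 → Fin 2 → (Fin 2 → ℝ) → ℝ)
    (v : Fin 2 → (Fin 2 → ℝ) → ℝ) : Prop :=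
  ∀ i j k : Fin 2, ∀ p ∈ U, killingOp Γ v i j k p = 0

theorem pd_congr {f g : (Fin 2 → ℝ) → ℝ} {p : Fin 2 → ℝ} (h : f =ᶠ[nhds p] g) (i : Fin 2) :
    pd f i p = pd g i p := by
  unfold pd
  rw [h.fderiv_eq]

theorem pd_const (c : ℝ) (i : Fin 2) (p : Fin 2 → ℝ) : pd (fun _ => c) i p = 0 := by
  simp [pd]

theorem pd_pd_comm {f : (Fin 2 → ℝ) → ℝ} {p : Fin 2 → ℝ}
    (hf : ContDiffAt ℝ (⊤ : ℕ∞) f p) (i j : Fin 2) :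
    pd (fun q => pd f j q) i p = pd (fun q => pd f i q) j p := by
  have hd : DifferentiableAt ℝ (fderiv ℝ f) p :=
    (hf.fderiv_right (m := 1) (by
      rw [one_add_one_eq_two]; exact WithTop.coe_le_coe.mpr (le_top : (2 : ℕ∞) ≤ ⊤))).differentiableAt (by simp)
  have hsymm : IsSymmSndFDerivAt ℝ f p :=
    hf.isSymmSndFDerivAt (by
      simp only [minSmoothness_of_isRCLikeNormedField]
      exact WithTop.coe_le_coe.mpr (le_top : (2 : ℕ∞) ≤ ⊤))
  have key : ∀ a b : Fin 2, pd (fun q => pd f a q) b p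
      = fderiv ℝ (fderiv ℝ f) p (Pi.single b 1) (Pi.single a 1) := by
    intro a b
    unfold pd
    rw [fderiv_clm_apply hd (differentiableAt_const _)]
    simp
  rw [key, key]
  exact hsymm _ _

/-- Quotient rule for dividing by the first coordinate. -/
theorem pd_div_coord {f : (Fin 2 → ℝ) → ℝ} {p : Fin 2 → ℝ}
    (hf : DifferentiableAt ℝ f p) (hp : p 0 ≠ 0) (i : Fin 2) :
    pd (fun q => f q / q 0) i p
      = (pd f i p * p 0 - f p * (Pi.single i 1 : Fin 2 → ℝ) 0) / p 0 ^ 2 := by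
  have hc : HasFDerivAt (fun q : Fin 2 → ℝ => q 0)
      (ContinuousLinearMap.proj (R := ℝ) (φ := fun _ : Fin 2 => ℝ) 0) p :=
    hasFDerivAt_apply 0 p
  unfold pd
  have h := hf.hasFDerivAt.mul ((hasDerivAt_inv hp).comp_hasFDerivAt p hc)
  have he : (fun q => f q / q 0) = f * (Inv.inv ∘ fun q : Fin 2 → ℝ => q 0) := by
    ext q
    simp [div_eq_mul_inv]
  rw [he, h.fderiv]
  simp
  field_simp
  ring

theorem fderiv_eq_zero_of_pd {f : (Fin 2 → ℝ) → ℝ} {p : Fin 2 → ℝ}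
    (h : ∀ i, pd f i p = 0) : fderiv ℝ f p = 0 := by
  apply ContinuousLinearMap.coe_injective
  ext i
  simpa [pd] using h i

theorem isOpen_halfPlane : IsOpen {p : Fin 2 → ℝ | 0 < p 0} :=
  isOpen_lt continuous_const (continuous_apply 0)

theorem convex_halfPlane : Convex ℝ {p : Fin 2 → ℝ | 0 < p 0} :=
  convex_halfSpace_gt (LinearMap.proj (R := ℝ) (φ := fun _ : Fin 2 => ℝ) 0).isLinear 0

theorem stmt14 (t1 : ℝ) (ht : t1 ≠ 0)
    (v : Fin 2 → (Fin 2 → ℝ) → ℝ)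
    (hv : ∀ i : Fin 2, ContDiffOn ℝ (⊤ : ℕ∞) (v i) {p : Fin 2 → ℝ | 0 < p 0}) :
    IsAffineKilling {p : Fin 2 → ℝ | 0 < p 0}
      (fun i j k => fun p : Fin 2 → ℝ =>
        ![![![(1 : ℝ), 0], ![t1 / p 0, 1]], ![![-t1 / p 0, 1], ![0, 0]]] i j k) v
    ↔ ∃ a : ℝ, ∀ p ∈ {p : Fin 2 → ℝ | 0 < p 0},
        v 0 p = 0 ∧ v 1 p = a := by
  have hU := isOpen_halfPlane
  constructor
  · intro hK
    have hC : ∀ i, ∀ p ∈ {p : Fin 2 → ℝ | 0 < p 0}, ContDiffAt ℝ (⊤ : ℕ∞) (v i) p :=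
      fun i p hp => (hv i).contDiffAt (hU.mem_nhds hp)
    have hfirst : ∀ p ∈ {p : Fin 2 → ℝ | 0 < p 0},
        pd (v 1) 0 p = 0 ∧ pd (v 1) 1 p = v 0 p / p 0 := by
      intro p hp
      have hp0 : p 0 ≠ 0 := ne_of_gt hp
      have h121 := hK 0 1 0 p hp
      have h211 := hK 1 0 0 p hp
      have h122 := hK 0 1 1 p hp
      have h212 := hK 1 0 1 p hp
      have e1 := pd_pd_comm (hC 0 p hp) 0 1
      have e2 := pd_pd_comm (hC 1 p hp) 0 1
      simp [killingOp, Fin.sum_univ_two, pd_const, pd_div_coord, hp0] at h121 h211 h122 h212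
      rw [e1] at h121
      rw [e2] at h122
      constructor
      · field_simp at h122 h212
        have : t1 * pd (v 1) 0 p = 0 := by linarith
        simpa [ht] using this
      · field_simp at h121 h211 ⊢
        have : t1 * (pd (v 1) 1 p * p 0 - v 0 p) = 0 := by linarith
        have := (mul_eq_zero.mp this).resolve_left ht
        linarith
    have hzero : ∀ p ∈ {p : Fin 2 → ℝ | 0 < p 0}, v 0 p = 0 := by
      intro p hp
      have hp0 : p 0 ≠ 0 := ne_of_gt hp
      have h212 := hK 1 0 1 p hp
      have e0 : pd (fun q => pd (v 1) 0 q) 1 p = 0 := by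
        rw [pd_congr (g := fun _ => 0), pd_const]
        filter_upwards [hU.mem_nhds hp] with q hq using (hfirst q hq).1
      have e1 : pd (fun q => pd (v 1) 1 q) 0 p = pd (fun q => v 0 q / q 0) 0 p :=
        pd_congr (by filter_upwards [hU.mem_nhds hp] with q hq using (hfirst q hq).2) 0
      rw [pd_pd_comm (hC 1 p hp), e0,
        pd_div_coord ((hC 0 p hp).differentiableAt (by simp)) hp0] at e1
      simp [killingOp, Fin.sum_univ_two, pd_const, e0, (hfirst p hp).1] at h212
      simpa [h212, hp0] using e1.symm
    obtain ⟨a, ha⟩ := hU.exists_is_const_of_fderiv_eq_zero convex_halfPlane.isPreconnected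
      ((hv 1).differentiableOn (by simp)) (fun p hp => fderiv_eq_zero_of_pd (fun i => by
        fin_cases i
        · exact (hfirst p hp).1
        · simpa [hzero p hp] using (hfirst p hp).2))
    exact ⟨a, fun p hp => ⟨hzero p hp, ha p hp⟩⟩
  · rintro ⟨a, ha⟩ i j k p hp
    have hpd : ∀ l m, ∀ q ∈ {p : Fin 2 → ℝ | 0 < p 0}, pd (v l) m q = 0 := by
      intro l m q hq
      rw [pd_congr (g := fun _ => ![0, a] l), pd_const]
      filter_upwards [hU.mem_nhds hq] with r hr
      fin_cases l
      · exact (ha r hr).1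
      · exact (ha r hr).2
    have hpd2 : pd (fun q => pd (v k) j q) i p = 0 := by
      rw [pd_congr (g := fun _ => 0), pd_const]
      filter_upwards [hU.mem_nhds hp] with q hq using hpd k j q hq
    have hp0 : p 0 ≠ 0 := ne_of_gt hp
    have h1 : ∀ l, pd (v l) i p = 0 := fun l => hpd l i p hp
    have h2 : ∀ l, pd (v l) j p = 0 := fun l => hpd l j p hp
    have h3 : ∀ l, pd (v k) l p = 0 := fun l => hpd k l p hp
    simp only [killingOp, hpd2, h1, h2, h3, Fin.sum_univ_two, (ha p hp).1]
    fin_cases i <;> fin_cases j <;> fin_cases k <;> simp [pd_const, pd_div_coord, hp0]
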